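/- Let a, d, k be positive integers with gcd(a,d)=1 and 2 ≤ k ≤ a, let a−1 = q(k−1)+r with 0 ≤ r < k−1, let λ ∈ ℂ with λ ≠ 0, λ^{a} = 1 and λ^{d} ≠ 1, and let μ be a positive integer. Then s_μ^{(λ)}(a, a+d, …, a+(k−1)d) = (1/(μ+1))·Σ_{n=0}^{μ} C(μ+1,n) B_n a^{n−1} Σ_{ℓ=0}^{μ+1−n} C(μ+1−n,ℓ) d^{ℓ} · ( Σ_{s=1}^{q} (sa)^{μ+1−n−ℓ} Σ_{j=(s−1)(k−1)+1}^{s(k−1)} λ^{jd} j^{ℓ} + ((q+1)a)^{μ+1−n−ℓ} Σ_{j=q(k−1)+1}^{q(k−1)+r} λ^{jd} j^{ℓ} ) + ((−1)^{μ+1}/(λ−1)^{μ+1})·Σ_{j=0}^{μ−1} ⟨μ, j⟩ λ^{j+1}. -/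

import Mathlib

open Finset

/-- `n` is representable as a nonnegative integer combination of the `a i`. -/
def Representable {k : ℕ} (a : Fin k → ℕ) (n : ℕ) : Prop :=
  ∃ x : Fin k → ℕ, n = ∑ i, x i * a i

/-- The set of positive integers that are not representable. -/
def NRset {k : ℕ} (a : Fin k → ℕ) : Set ℕ :=
  {n | 0 < n ∧ ¬ Representable a n}

/-- Eulerian numbers `⟨n,m⟩ = Σ_{k=0}^{m} (−1)^k C(n+1,k)(m−k+1)^n`. -/
def eulerianNum (n m : ℕ) : ℤ :=
  ∑ k ∈ Finset.range (m + 1), (-1 : ℤ) ^ k * ((n + 1).choose k : ℤ) * ((m - k + 1 : ℕ) : ℤ) ^ n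

theorem coeff_one_sub_X_pow_mul (n m : ℕ) (f : ℕ → ℂ) :
    PowerSeries.coeff m ((1 - PowerSeries.X) ^ n * PowerSeries.mk f) =
      ∑ k ∈ range (m + 1), (-1 : ℂ) ^ k * (n.choose k : ℂ) * f (m - k) := by
  have h : ∀ k, PowerSeries.coeff k ((1 - PowerSeries.X : PowerSeries ℂ) ^ n) =
      (-1 : ℂ) ^ k * (n.choose k : ℂ) := by
    intro k
    have h1 : (1 - PowerSeries.X : PowerSeries ℂ) ^ n =
        PowerSeries.rescale (-1) (((1 + Polynomial.X : Polynomial ℂ) ^ n : Polynomial ℂ) :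
          PowerSeries ℂ) := by
      simp [sub_eq_add_neg]
    rw [h1, PowerSeries.coeff_rescale, Polynomial.coeff_coe, Polynomial.coeff_one_add_X_pow]
  rw [PowerSeries.coeff_mul, Finset.Nat.sum_antidiagonal_eq_sum_range_succ_mk]
  simp [h]

theorem sum_alternating_choose_mul_sub_pow_eq_zero (n m : ℕ) (h : n < m) :
    ∑ k ∈ range (m + 1), (-1 : ℂ) ^ k * ((n + 1).choose k : ℂ) * ((m - k : ℕ) : ℂ) ^ n = 0 := by
  have h0 := congrFun (fwdDiff_iter_pow_eq_zero_of_lt (R := ℂ) (Nat.lt_succ_self n))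
    ((m - (n + 1) : ℕ) : ℂ)
  rw [fwdDiff_iter_eq_sum_shift, ← Finset.sum_range_reflect] at h0
  rw [← Finset.sum_subset (Finset.range_mono (show n + 2 ≤ m + 1 by omega))]
  · refine Eq.trans (Finset.sum_congr rfl fun k hk => ?_) h0
    have hk' : k ≤ n + 1 := by simpa [Nat.lt_succ_iff] using hk
    have e1 : n.succ + 1 - 1 - k = n + 1 - k := by omega
    have e2 : n.succ - (n + 1 - k) = k := by omega
    have e3 : ((m - k : ℕ) : ℂ) = ((m - (n + 1) : ℕ) : ℂ) + ((n + 1 - k : ℕ) : ℂ) := by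
      rw [← Nat.cast_add]; congr 1; omega
    rw [e1, e2, e3, Nat.succ_eq_add_one, Nat.choose_symm hk']
    simp
  · intro k _ hk
    rw [Nat.choose_eq_zero_of_lt (not_le.1 fun h' => hk (Finset.mem_range.2 (by omega)))]
    simp

/-- Numerator of `∑ iⁿ Xⁱ` over the denominator `(1 - X) ^ (n + 1)`. -/
noncomputable def eulerianPoly (n : ℕ) : Polynomial ℂ :=
  if n = 0 then 1
  else ∑ j ∈ range n, Polynomial.C (eulerianNum n j : ℂ) * Polynomial.X ^ (j + 1)

theorem coe_eulerianPoly (n : ℕ) : (eulerianPoly n : PowerSeries ℂ) =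
    (1 - PowerSeries.X) ^ (n + 1) * PowerSeries.mk fun i => (i : ℂ) ^ n := by
  rcases Nat.eq_zero_or_pos n with rfl | hn
  · have h := (PowerSeries.mk_one_mul_one_sub_eq_one ℂ).symm
    rw [mul_comm] at h
    simpa [eulerianPoly, Pi.one_def] using h
  ext m
  rw [coeff_one_sub_X_pow_mul, Polynomial.coeff_coe, eulerianPoly, if_neg hn.ne']
  simp only [Polynomial.finsetSum_coeff, Polynomial.coeff_C_mul_X_pow]
  rcases m with _ | m
  · simp [hn.ne']
  rcases lt_or_ge m n with hm | hm
  · rw [Finset.sum_eq_single_of_mem m (by simpa using hm)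
      (fun b _ hb => if_neg (by omega)), if_pos rfl, Finset.sum_range_succ, eulerianNum]
    simp only [Nat.sub_self, Nat.cast_zero, zero_pow hn.ne', mul_zero, add_zero]
    push_cast
    refine Finset.sum_congr rfl fun k hk => ?_
    have : m + 1 - k = m - k + 1 := by
      have := Finset.mem_range.1 hk
      omega
    rw [this]
    push_cast
    rfl
  · rw [sum_alternating_choose_mul_sub_pow_eq_zero n (m + 1) (by omega)]
    refine Finset.sum_eq_zero fun j hj => if_neg ?_
    have := Finset.mem_range.1 hj
    omega

theorem eulerianPoly_recurrence (n : ℕ) (hn : 0 < n) : eulerianPoly n =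
    Polynomial.X * ∑ i ∈ range (n + 1),
      (n.choose i : Polynomial ℂ) * (1 - Polynomial.X) ^ (n - i) * eulerianPoly i := by
  have hP : (PowerSeries.mk fun i => (i : ℂ) ^ n) = PowerSeries.X * ∑ i ∈ range (n + 1),
      (n.choose i : PowerSeries ℂ) * PowerSeries.mk fun j => (j : ℂ) ^ i := by
    ext m
    rcases m with _ | m
    · simp [hn.ne']
    · simp only [PowerSeries.coeff_mk, PowerSeries.coeff_succ_X_mul, map_sum]
      push_cast
      rw [add_pow]
      refine Finset.sum_congr rfl fun i _ => ?_
      rw [← map_natCast (PowerSeries.C (R := ℂ)), PowerSeries.coeff_C_mul]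
      simp [mul_comm]
  apply Polynomial.coe_injective
  simp only [Polynomial.coe_mul, Polynomial.coe_X]
  rw [coe_eulerianPoly, hP, mul_left_comm, Finset.mul_sum]
  congr 1
  rw [← Polynomial.coeToPowerSeries.ringHom_apply, map_sum]
  refine Finset.sum_congr rfl fun i hi => ?_
  have : n + 1 = n - i + (i + 1) := by
    have := Finset.mem_range.1 hi
    omega
  simp only [map_mul, map_pow, map_natCast, map_sub, map_one,
    Polynomial.coeToPowerSeries.ringHom_apply, Polynomial.coe_X, coe_eulerianPoly]
  rw [this, pow_add]
  ring

open PowerSeries in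
theorem eulerian_generating_function (x : ℂ) (hx : x ≠ 1) :
    (mk fun n => (eulerianPoly n).eval x / (1 - x) ^ (n + 1) / (n.factorial : ℂ)) *
      (1 - C x * exp ℂ) = 1 := by
  have hx' : 1 - x ≠ 0 := sub_ne_zero.2 hx.symm
  rw [mul_sub, mul_one, mul_left_comm]
  ext n
  rw [map_sub, coeff_C_mul, coeff_mul, Finset.Nat.sum_antidiagonal_eq_sum_range_succ_mk]
  simp only [coeff_mk, coeff_exp, coeff_one]
  rcases Nat.eq_zero_or_pos n with rfl | hn
  · simp [eulerianPoly]
    field_simp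
  rw [if_neg hn.ne', sub_eq_zero, eulerianPoly_recurrence n hn]
  simp only [Polynomial.eval_mul, Polynomial.eval_X, Polynomial.eval_finsetSum,
    Polynomial.eval_pow, Polynomial.eval_sub, Polynomial.eval_one, Polynomial.eval_natCast]
  rw [mul_div_assoc, mul_div_assoc, Finset.sum_div, Finset.sum_div]
  congr 1
  refine Finset.sum_congr rfl fun i hi => ?_
  have hi' : i ≤ n := Nat.lt_succ_iff.1 (Finset.mem_range.1 hi)
  have h1 : n + 1 = n - i + (i + 1) := by omega
  rw [h1, pow_add (1 - x) (n - i) (i + 1), Nat.cast_choose ℂ hi']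
  have := Nat.factorial_ne_zero n
  have := Nat.factorial_ne_zero i
  have := Nat.factorial_ne_zero (n - i)
  simp
  field_simp

open PowerSeries in
theorem sum_pow_mul_bernoulli (a : ℕ) (ha : 0 < a) (x : ℂ) (hx : x ^ a = 1) (hx1 : x ≠ 1)
    (m : ℕ) :
    (a : ℂ) ^ m / ((m : ℂ) + 1) * ∑ r ∈ range a, x ^ r *
      Polynomial.aeval ((r : ℂ) / a) (Polynomial.bernoulli (m + 1)) =
      -((eulerianPoly m).eval x / (1 - x) ^ (m + 1)) := by
  have ha' : (a : ℂ) ≠ 0 := Nat.cast_ne_zero.2 ha.ne'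
  set b : ℕ → PowerSeries ℂ := fun r => rescale (a : ℂ)
    (mk fun n => Polynomial.aeval ((r : ℂ) / a) ((1 / n.factorial : ℚ) • Polynomial.bernoulli n))
    with hb
  set E : PowerSeries ℂ := mk fun n => (eulerianPoly n).eval x / (1 - x) ^ (n + 1) /
    (n.factorial : ℂ) with hE
  have hgen : ∀ r, b r * (exp ℂ ^ a - 1) = C (a : ℂ) * X * exp ℂ ^ r := by
    intro r
    have := congrArg (rescale (a : ℂ)) (Polynomial.bernoulli_generating_function ((r : ℂ) / a))
    rw [map_mul, map_sub, map_one, map_mul, rescale_X, rescale_rescale,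
      ← exp_pow_eq_rescale_exp] at this
    rw [hb, this, exp_pow_eq_rescale_exp]
    congr 3
    field_simp
  have hne : (exp ℂ ^ a - 1 : PowerSeries ℂ) ≠ 0 := by
    intro h
    have := congrArg (coeff 1) h
    rw [exp_pow_eq_rescale_exp] at this
    simp [coeff_rescale, coeff_exp, coeff_one, ha.ne'] at this
  have hsum : (∑ r ∈ range a, C (x ^ r) * b r) * (C x * exp ℂ - 1) = C (a : ℂ) * X := by
    apply mul_right_cancel₀ hne
    have hgeom := geom_sum_mul (C x * exp ℂ) a
    rw [mul_pow, ← map_pow, hx, map_one, one_mul] at hgeom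
    have h : (∑ r ∈ range a, C (x ^ r) * b r) * (exp ℂ ^ a - 1) =
        C (a : ℂ) * X * ∑ r ∈ range a, (C x * exp ℂ) ^ r := by
      rw [Finset.sum_mul, Finset.mul_sum]
      refine Finset.sum_congr rfl fun r _ => ?_
      rw [mul_assoc, hgen, mul_pow, map_pow]
      ring
    linear_combination (C x * exp ℂ - 1) * h + C (a : ℂ) * X * hgeom
  have key : ∑ r ∈ range a, C (x ^ r) * b r = -(C (a : ℂ) * X * E) := by
    have h1 := eulerian_generating_function x hx1
    rw [← hE] at h1
    linear_combination (-E) * hsum - (∑ r ∈ range a, C (x ^ r) * b r) * h1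
  have hc := congrArg (coeff (m + 1)) key
  rw [map_neg, mul_assoc, coeff_C_mul, coeff_succ_X_mul, hE, coeff_mk, map_sum] at hc
  simp only [coeff_C_mul, hb, coeff_rescale, coeff_mk, map_smul] at hc
  have hf : (m.factorial : ℂ) ≠ 0 := Nat.cast_ne_zero.2 (Nat.factorial_ne_zero m)
  have hm : (m : ℂ) + 1 ≠ 0 := Nat.cast_add_one_ne_zero m
  have hx' : 1 - x ≠ 0 := sub_ne_zero.2 hx1.symm
  have h2 : (a : ℂ) ^ m / ((m : ℂ) + 1) * ∑ r ∈ range a, x ^ r *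
      Polynomial.aeval ((r : ℂ) / a) (Polynomial.bernoulli (m + 1)) =
      m.factorial / a * ∑ r ∈ range a, x ^ r * ((a : ℂ) ^ (m + 1) *
        ((1 / ((m + 1).factorial : ℚ)) •
          Polynomial.aeval ((r : ℂ) / a) (Polynomial.bernoulli (m + 1)))) := by
    rw [Finset.mul_sum, Finset.mul_sum]
    refine Finset.sum_congr rfl fun r _ => ?_
    rw [Algebra.smul_def, Nat.factorial_succ]
    simp
    field_simp
    ring
  rw [h2, hc]
  field_simp

theorem representable_arith_iff (a d k n : ℕ) (hk : 2 ≤ k) :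
    Representable (fun j : Fin k => a + (j : ℕ) * d) n ↔
      ∃ t j, j ≤ t * (k - 1) ∧ n = t * a + j * d := by
  constructor
  · rintro ⟨x, rfl⟩
    refine ⟨∑ i, x i, ∑ i, x i * (i : ℕ), ?_, ?_⟩
    · rw [Finset.sum_mul]
      exact Finset.sum_le_sum fun i _ => Nat.mul_le_mul_left _ (by omega)
    · rw [Finset.sum_mul, Finset.sum_mul, ← Finset.sum_add_distrib]
      exact Finset.sum_congr rfl fun i _ => by ring
  · rintro ⟨t, j, hj, rfl⟩
    induction t generalizing j with
    | zero =>
      obtain rfl : j = 0 := by simpa using hj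
      exact ⟨0, by simp⟩
    | succ t ih =>
      have hi : min j (k - 1) < k := by omega
      obtain ⟨x, hx⟩ := ih (j - min j (k - 1)) (by rw [add_mul] at hj; omega)
      refine ⟨x + Pi.single ⟨min j (k - 1), hi⟩ 1, ?_⟩
      simp only [Pi.add_apply, add_mul, Finset.sum_add_distrib, ← hx, Pi.single_apply, ite_mul,
        one_mul, zero_mul, Finset.sum_ite_eq', Finset.mem_univ, if_true]
      have : j * d = (j - min j (k - 1)) * d + min j (k - 1) * d := by
        rw [← add_mul]; congr 1; omega
      omega

/-- The least representable integer congruent to `j * d` modulo `a`, for `j < a`. -/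
def apery (a d k j : ℕ) : ℕ := (j + (k - 2)) / (k - 1) * a + j * d

theorem apery_mod (a d k j : ℕ) : apery a d k j % a = j * d % a := by
  simp [apery, Nat.add_mod]

theorem eq_of_mul_mod_eq {a d i j : ℕ} (hgcd : Nat.gcd a d = 1) (hi : i < a) (hj : j < a)
    (h : i * d % a = j * d % a) : i = j :=
  Nat.ModEq.eq_of_lt_of_lt (Nat.ModEq.cancel_right_of_coprime hgcd h) hi hj

theorem image_mul_mod_range (a d : ℕ) (hgcd : Nat.gcd a d = 1) (ha : 0 < a) :
    (range a).image (fun j => j * d % a) = range a := by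
  apply Finset.eq_of_subset_of_card_le
  · intro n hn
    obtain ⟨j, _, rfl⟩ := Finset.mem_image.1 hn
    exact Finset.mem_range.2 (Nat.mod_lt _ ha)
  · rw [Finset.card_image_of_injOn]
    intro i hi j hj h
    exact eq_of_mul_mod_eq hgcd (by simpa using hi) (by simpa using hj) h

theorem representable_iff_apery_le (a d k j n : ℕ) (hk : 2 ≤ k) (hgcd : Nat.gcd a d = 1)
    (hj : j < a) (hn : n % a = j * d % a) :
    Representable (fun j : Fin k => a + (j : ℕ) * d) n ↔ apery a d k j ≤ n := by
  have hk1 : 0 < k - 1 := by omega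
  rw [representable_arith_iff a d k n hk]
  constructor
  · rintro ⟨t, i, hi, rfl⟩
    have hij : i % a = j := by
      apply eq_of_mul_mod_eq hgcd (Nat.mod_lt _ (by omega)) hj
      rw [Nat.mod_mul_mod, ← hn]
      simp [Nat.add_mod]
    have hle : j ≤ i := hij ▸ Nat.mod_le _ _
    apply Nat.add_le_add (Nat.mul_le_mul_right _ _) (Nat.mul_le_mul_right _ hle)
    rw [← Nat.lt_succ_iff, Nat.div_lt_iff_lt_mul hk1, Nat.succ_mul]
    omega
  · intro h
    have hmod : apery a d k j ≡ n [MOD a] := (apery_mod a d k j).trans hn.symm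
    obtain ⟨u, hu⟩ := (Nat.modEq_iff_dvd' h).1 hmod
    refine ⟨(j + (k - 2)) / (k - 1) + u, j, ?_, ?_⟩
    · have := Nat.lt_div_mul_add (a := j + (k - 2)) hk1
      rw [add_mul]
      omega
    · have : n = apery a d k j + a * u := by omega
      rw [this, apery]
      ring

theorem finsum_NRset_eq (a d k : ℕ) (ha : 0 < a) (hk : 2 ≤ k) (hgcd : Nat.gcd a d = 1)
    (f : ℕ → ℂ) :
    ∑ᶠ n ∈ NRset (fun j : Fin k => a + (j : ℕ) * d), f n =
      ∑ j ∈ range a, ∑ i ∈ range (apery a d k j / a), f (j * d % a + i * a) := by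
  have hset : NRset (fun j : Fin k => a + (j : ℕ) * d) =
      ↑(((range a).sigma fun j => range (apery a d k j / a)).image
        fun p => p.1 * d % a + p.2 * a) := by
    ext n
    simp only [NRset, Set.mem_ofPred_eq, Finset.coe_image, Set.mem_image, Finset.mem_coe,
      Finset.mem_sigma, Finset.mem_range, Sigma.exists]
    constructor
    · rintro ⟨-, hn⟩
      have hmem : n % a ∈ range a := Finset.mem_range.2 (Nat.mod_lt _ ha)
      rw [← image_mul_mod_range a d hgcd ha] at hmem
      obtain ⟨j, hj, hjn⟩ := Finset.mem_image.1 hmem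
      rw [Finset.mem_range] at hj
      rw [representable_iff_apery_le a d k j n hk hgcd hj hjn.symm, not_le] at hn
      refine ⟨j, n / a, ⟨hj, ?_⟩, ?_⟩
      · by_contra hlt
        have h1 := Nat.mul_le_mul_left a (not_lt.1 hlt)
        have h2 := Nat.div_add_mod n a
        have h3 := Nat.div_add_mod (apery a d k j) a
        rw [apery_mod, hjn] at h3
        omega
      · rw [hjn, mul_comm]
        exact Nat.mod_add_div n a
    · rintro ⟨j, i, ⟨hj, hi⟩, rfl⟩
      have hlt : j * d % a + i * a < apery a d k j := by
        have h1 := Nat.mul_le_mul_left a (Nat.succ_le_of_lt hi)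
        have h3 := Nat.div_add_mod (apery a d k j) a
        rw [apery_mod] at h3
        rw [Nat.mul_succ, mul_comm a i] at h1
        omega
      have hnr := (representable_iff_apery_le a d k j (j * d % a + i * a) hk hgcd hj
        (by simp)).not.2 (not_le.2 hlt)
      refine ⟨Nat.pos_of_ne_zero fun h0 => hnr ?_, hnr⟩
      rw [h0]
      exact ⟨0, by simp⟩
  rw [hset, finsum_mem_coe_finset, Finset.sum_image, Finset.sum_sigma]
  rintro ⟨j, i⟩ hp ⟨j', i'⟩ hp' h
  simp only [Finset.coe_sigma, Set.mem_sigma_iff, Finset.coe_range, Set.mem_Iio] at hp hp' h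
  obtain rfl : j = j' := by
    apply eq_of_mul_mod_eq hgcd hp.1 hp'.1
    simpa using congrArg (· % a) h
  obtain rfl : i = i' := Nat.eq_of_mul_eq_mul_right ha (Nat.add_left_cancel h)
  rfl

/-- Summation over consecutive blocks of length `k - 1`. -/
theorem sum_blocks (k q r : ℕ) (hk : 2 ≤ k) (hr : r < k - 1) (g : ℕ → ℕ → ℂ) :
    ∑ s ∈ Icc 1 q, ∑ j ∈ Icc ((s - 1) * (k - 1) + 1) (s * (k - 1)), g s j +
      ∑ j ∈ Icc (q * (k - 1) + 1) (q * (k - 1) + r), g (q + 1) j =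
    ∑ j ∈ Icc 1 (q * (k - 1) + r), g ((j + (k - 2)) / (k - 1)) j := by
  have hblock : ∀ s u, u ≤ k - 1 →
      ∑ j ∈ Icc (s * (k - 1) + 1) (s * (k - 1) + u), g ((j + (k - 2)) / (k - 1)) j =
        ∑ j ∈ Icc (s * (k - 1) + 1) (s * (k - 1) + u), g (s + 1) j := by
    intro s u hu
    refine Finset.sum_congr rfl fun j hj => ?_
    obtain ⟨h1, h2⟩ := Finset.mem_Icc.1 hj
    congr 1
    refine Nat.div_eq_of_lt_le ?_ ?_
    · rw [Nat.add_mul]; omega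
    · rw [Nat.add_mul, Nat.add_mul]; omega
  have hsplit : ∀ (f : ℕ → ℂ) m u,
      ∑ j ∈ Icc 1 (m + u), f j = ∑ j ∈ Icc 1 m, f j + ∑ j ∈ Icc (m + 1) (m + u), f j := by
    intro f m u
    have h := Finset.sum_Ioc_consecutive f (Nat.zero_le m) (Nat.le_add_right m u)
    simpa [← Finset.Icc_succ_left_eq_Ioc] using h.symm
  have hfull : ∑ s ∈ Icc 1 q, ∑ j ∈ Icc ((s - 1) * (k - 1) + 1) (s * (k - 1)), g s j =
      ∑ j ∈ Icc 1 (q * (k - 1)), g ((j + (k - 2)) / (k - 1)) j := by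
    clear hr
    induction q with
    | zero => simp
    | succ q ih =>
      rw [Finset.sum_Icc_succ_top (by omega), ih, Nat.add_sub_cancel, add_mul, one_mul, hsplit,
        hblock q _ le_rfl]
  rw [hsplit, hfull, hblock q r hr.le]

/-- The polynomial `x ↦ a ^ m * B_{m+1}(x / a) / (m + 1)`, a discrete antiderivative of `x ^ m`
with step `a`. -/
noncomputable def scaledBernoulli (a m : ℕ) (x : ℂ) : ℂ :=
  (a : ℂ) ^ m / ((m : ℂ) + 1) * Polynomial.aeval (x / a) (Polynomial.bernoulli (m + 1))

theorem scaledBernoulli_add (a m : ℕ) (ha : 0 < a) (x : ℂ) :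
    scaledBernoulli a m (x + a) = scaledBernoulli a m x + x ^ m := by
  have ha' : (a : ℂ) ≠ 0 := Nat.cast_ne_zero.2 ha.ne'
  have hm : (m : ℂ) + 1 ≠ 0 := Nat.cast_add_one_ne_zero m
  have h := congrArg (Polynomial.aeval (x / a)) (Polynomial.bernoulli_comp_one_add_X (m + 1))
  rw [Polynomial.aeval_comp] at h
  simp only [map_add, map_one, Polynomial.aeval_X, map_nsmul, map_pow, Nat.add_sub_cancel] at h
  have e : (x + a) / a = 1 + x / a := by field_simp; ring
  rw [scaledBernoulli, scaledBernoulli, e, h, nsmul_eq_mul, div_pow]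
  push_cast
  field_simp

theorem sum_arith_pow_eq (a m : ℕ) (ha : 0 < a) (x : ℂ) (T : ℕ) :
    ∑ i ∈ range T, (x + i * a) ^ m =
      scaledBernoulli a m (x + T * a) - scaledBernoulli a m x := by
  induction T with
  | zero => simp
  | succ T ih =>
    have h := scaledBernoulli_add a m ha (x + T * a)
    have e : x + ((T + 1 : ℕ) : ℂ) * a = x + T * a + a := by push_cast; ring
    rw [Finset.sum_range_succ, ih, e, h]
    ring

theorem scaledBernoulli_sub_zero (a m : ℕ) (ha : 0 < a) (x : ℂ) :
    scaledBernoulli a m x - scaledBernoulli a m 0 =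
      (1 / ((m : ℂ) + 1)) * ∑ n ∈ range (m + 1),
        ((m + 1).choose n : ℂ) * ((bernoulli n : ℚ) : ℂ) * (a : ℂ) ^ ((n : ℤ) - 1) *
          x ^ (m + 1 - n) := by
  have ha' : (a : ℂ) ≠ 0 := Nat.cast_ne_zero.2 ha.ne'
  have hm : (m : ℂ) + 1 ≠ 0 := Nat.cast_add_one_ne_zero m
  simp only [scaledBernoulli, Polynomial.bernoulli, map_sum, Polynomial.aeval_monomial]
  rw [← mul_sub, ← Finset.sum_sub_distrib, Finset.sum_range_succ]
  simp only [Nat.sub_self, pow_zero, sub_self, add_zero]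
  rw [Finset.mul_sum, Finset.mul_sum]
  refine Finset.sum_congr rfl fun n hn => ?_
  have hn' : n ≤ m := Nat.lt_succ_iff.1 (Finset.mem_range.1 hn)
  have hp : (a : ℂ) ^ m * (a : ℂ) = (a : ℂ) ^ n * (a : ℂ) ^ (m + 1 - n) := by
    rw [← pow_succ, ← pow_add]; congr 1; omega
  rw [zero_div, zero_pow (by omega), mul_zero, sub_zero, div_pow, zpow_sub_one₀ ha',
    zpow_natCast]
  simp only [map_mul, eq_ratCast, map_natCast]
  field_simp
  linear_combination ((bernoulli n : ℚ) : ℂ) * ((m + 1).choose n : ℂ) * x ^ (m + 1 - n) * hp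

/-- Every term of the Bernoulli expansion collects into a sum over the Apéry set. -/
theorem sum_choose_mul_blocks (a d k q r : ℕ) (hk : 2 ≤ k) (hqr : a - 1 = q * (k - 1) + r)
    (hr : r < k - 1) (x : ℂ) (p : ℕ) :
    ∑ l ∈ range (p + 1), (p.choose l : ℂ) * (d : ℂ) ^ l *
      ( ∑ s ∈ Icc 1 q, ((s * a : ℕ) : ℂ) ^ (p - l) *
          ∑ j ∈ Icc ((s - 1) * (k - 1) + 1) (s * (k - 1)), x ^ (j * d) * (j : ℂ) ^ l
        + (((q + 1) * a : ℕ) : ℂ) ^ (p - l) *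
          ∑ j ∈ Icc (q * (k - 1) + 1) (q * (k - 1) + r), x ^ (j * d) * (j : ℂ) ^ l ) =
    ∑ j ∈ Icc 1 (a - 1), x ^ (j * d) * (apery a d k j : ℂ) ^ p := by
  have hblocks : ∀ l, ∑ s ∈ Icc 1 q, ((s * a : ℕ) : ℂ) ^ (p - l) *
        ∑ j ∈ Icc ((s - 1) * (k - 1) + 1) (s * (k - 1)), x ^ (j * d) * (j : ℂ) ^ l
      + (((q + 1) * a : ℕ) : ℂ) ^ (p - l) *
        ∑ j ∈ Icc (q * (k - 1) + 1) (q * (k - 1) + r), x ^ (j * d) * (j : ℂ) ^ l =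
      ∑ j ∈ Icc 1 (a - 1), (((j + (k - 2)) / (k - 1) * a : ℕ) : ℂ) ^ (p - l) *
        (x ^ (j * d) * (j : ℂ) ^ l) := by
    intro l
    simp only [Finset.mul_sum]
    rw [hqr]
    exact sum_blocks k q r hk hr
      fun s j => ((s * a : ℕ) : ℂ) ^ (p - l) * (x ^ (j * d) * (j : ℂ) ^ l)
  simp only [hblocks]
  simp only [Finset.mul_sum]
  rw [Finset.sum_comm]
  refine Finset.sum_congr rfl fun j _ => ?_
  rw [apery, Nat.cast_add, add_comm (Nat.cast _), add_pow, Finset.mul_sum]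
  refine Finset.sum_congr rfl fun l _ => ?_
  rw [Nat.cast_mul j d, mul_pow]
  ring

theorem sum_range_eq_sum_Icc_of_zero (a : ℕ) (ha : 0 < a) (f : ℕ → ℂ) (h0 : f 0 = 0) :
    ∑ j ∈ range a, f j = ∑ j ∈ Icc 1 (a - 1), f j := by
  obtain ⟨b, rfl⟩ : ∃ b, a = b + 1 := ⟨a - 1, by omega⟩
  rw [Finset.sum_range_succ', h0, add_zero, Nat.add_sub_cancel, Finset.range_eq_Ico,
    Finset.sum_Ico_add' f 0 b 1]
  rfl

/-- Weighted Sylvester power sum for an arithmetic sequence, `λ^a = 1`, `λ^d ≠ 1`. -/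
theorem stmt19 (a d k q r : ℕ) (ha : 0 < a) (hd : 0 < d)
    (hk : 2 ≤ k) (hka : k ≤ a) (hgcd : Nat.gcd a d = 1)
    (hqr : a - 1 = q * (k - 1) + r) (hr : r < k - 1)
    (lam : ℂ) (hl0 : lam ≠ 0) (hla : lam ^ a = 1) (hld : lam ^ d ≠ 1)
    (μ : ℕ) (hμ : 0 < μ) :
    ∑ᶠ n ∈ NRset (fun j : Fin k => a + (j : ℕ) * d), lam ^ n * (n : ℂ) ^ μ =
      (1 / ((μ : ℂ) + 1)) * ∑ n ∈ Finset.range (μ + 1),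
        ((μ + 1).choose n : ℂ) * ((bernoulli n : ℚ) : ℂ) * (a : ℂ) ^ ((n : ℤ) - 1) *
          ∑ l ∈ Finset.range (μ + 1 - n + 1), ((μ + 1 - n).choose l : ℂ) * (d : ℂ) ^ l *
            ( ∑ s ∈ Finset.Icc 1 q, ((s * a : ℕ) : ℂ) ^ (μ + 1 - n - l) *
                ∑ j ∈ Finset.Icc ((s - 1) * (k - 1) + 1) (s * (k - 1)),
                  lam ^ (j * d) * (j : ℂ) ^ l
              + (((q + 1) * a : ℕ) : ℂ) ^ (μ + 1 - n - l) *
                ∑ j ∈ Finset.Icc (q * (k - 1) + 1) (q * (k - 1) + r),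
                  lam ^ (j * d) * (j : ℂ) ^ l )
        + ((-1 : ℂ) ^ (μ + 1) / (lam - 1) ^ (μ + 1)) *
            ∑ j ∈ Finset.range μ, (eulerianNum μ j : ℂ) * lam ^ (j + 1) := by
  have hl1 : lam ≠ 1 := fun h => hld (by rw [h, one_pow])
  have hmod : ∀ n, lam ^ (n % a) = lam ^ n := fun n => (pow_eq_pow_mod n hla).symm
  have hreindex : ∀ f : ℕ → ℂ, ∑ j ∈ range a, f (j * d % a) = ∑ j ∈ range a, f j := by
    intro f
    conv_rhs => rw [← image_mul_mod_range a d hgcd ha]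
    rw [Finset.sum_image]
    intro i hi j hj h
    exact eq_of_mul_mod_eq hgcd (by simpa using hi) (by simpa using hj) h
  have hroots : ∑ j ∈ range a, lam ^ (j * d) = 0 := by
    have h := hreindex fun n => lam ^ n
    simp only [hmod] at h
    rw [h, geom_sum_eq hl1, hla, sub_self, zero_div]
  have happ : ∀ j, (apery a d k j : ℂ) =
      ((j * d % a : ℕ) : ℂ) + ((apery a d k j / a : ℕ) : ℂ) * a := by
    intro j
    rw [← apery_mod a d k j]
    exact_mod_cast (Nat.mod_add_div' (apery a d k j) a).symm
  have hleft : ∑ᶠ n ∈ NRset (fun j : Fin k => a + (j : ℕ) * d), lam ^ n * (n : ℂ) ^ μ =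
      ∑ j ∈ range a, lam ^ (j * d) *
          (scaledBernoulli a μ (apery a d k j) - scaledBernoulli a μ 0) -
        ∑ r ∈ range a, lam ^ r * scaledBernoulli a μ r := by
    rw [finsum_NRset_eq a d k ha hk hgcd,
      ← hreindex fun r => lam ^ r * scaledBernoulli a μ r]
    simp only [mul_sub]
    rw [Finset.sum_sub_distrib, ← Finset.sum_mul, hroots, zero_mul, sub_zero,
      ← Finset.sum_sub_distrib]
    refine Finset.sum_congr rfl fun j _ => ?_
    rw [hmod, ← mul_sub, happ j, ← sum_arith_pow_eq a μ ha, Finset.mul_sum]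
    refine Finset.sum_congr rfl fun i _ => ?_
    rw [pow_add, hmod, mul_comm i a, pow_mul lam a i, hla, one_pow, mul_one]
    push_cast
    ring
  have heuler : ∑ r ∈ range a, lam ^ r * scaledBernoulli a μ r =
      -((-1 : ℂ) ^ (μ + 1) / (lam - 1) ^ (μ + 1) *
        ∑ j ∈ range μ, (eulerianNum μ j : ℂ) * lam ^ (j + 1)) := by
    have h := sum_pow_mul_bernoulli a ha lam hla hl1 μ
    have hsign : (lam - 1) ^ (μ + 1) = (-1) ^ (μ + 1) * (1 - lam) ^ (μ + 1) := by
      rw [← mul_pow]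
      congr 1
      ring
    have h1 : (1 - lam) ^ (μ + 1) ≠ 0 := pow_ne_zero _ (sub_ne_zero.2 hl1.symm)
    have h2 : (-1 : ℂ) ^ (μ + 1) ≠ 0 := pow_ne_zero _ (by norm_num)
    rw [eulerianPoly, if_neg hμ.ne'] at h
    simp only [Polynomial.eval_finsetSum, Polynomial.eval_mul, Polynomial.eval_C,
      Polynomial.eval_pow, Polynomial.eval_X] at h
    rw [hsign, div_mul_cancel_left₀ h2, inv_mul_eq_div, ← h, Finset.mul_sum]
    refine Finset.sum_congr rfl fun r _ => ?_
    rw [scaledBernoulli]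
    ring
  rw [hleft, heuler, sub_neg_eq_add]
  congr 1
  simp only [sum_choose_mul_blocks a d k q r hk hqr hr]
  have hzero : apery a d k 0 = 0 := by
    simp [apery, Nat.div_eq_of_lt (show k - 2 < k - 1 by omega)]
  rw [sum_range_eq_sum_Icc_of_zero a ha _ (by simp [hzero])]
  simp only [scaledBernoulli_sub_zero a μ ha, Finset.mul_sum]
  rw [Finset.sum_comm]
  refine Finset.sum_congr rfl fun n _ => Finset.sum_congr rfl fun j _ => ?_
  ring
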